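/- Let Ω = [0,L₁] × [0,L₂] be a periodic domain, ν > 0, μ > 0, and k ≥ 1 an integer. Suppose φ : [0,∞) × ℝ² → ℝ is smooth and periodic in the spatial variables, v : [0,∞) × ℝ² → ℝ² is a smooth spatially periodic vector field with div v(t,·) = 0 for all t, g : [0,∞) × ℝ² → ℝ is smooth and spatially periodic, and ∂_t φ + v·∇φ = ν Δφ − μ φ + g holds on [0,∞) × ℝ². Then for all τ ≥ 0 and t ≥ 0, ‖φ(t+τ)‖_{L^{2k}(Ω)} ≤ ‖φ(τ)‖_{L^{2k}(Ω)} e^{−μt} + μ^{−1} sup_{s ∈ [τ,∞)} ‖g(s)‖_{L^{2k}(Ω)} · (1 − e^{−μt}). -/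

import Mathlib

open MeasureTheory Real

/-- First partial derivative of a function on `ℝ²`. -/
noncomputable def pd1 (f : ℝ × ℝ → ℝ) (p : ℝ × ℝ) : ℝ :=
  deriv (fun s => f (s, p.2)) p.1

/-- Second partial derivative of a function on `ℝ²`. -/
noncomputable def pd2 (f : ℝ × ℝ → ℝ) (p : ℝ × ℝ) : ℝ :=
  deriv (fun s => f (p.1, s)) p.2

/-- The Laplacian `Δf = ∂₁²f + ∂₂²f`. -/
noncomputable def lap (f : ℝ × ℝ → ℝ) (p : ℝ × ℝ) : ℝ :=
  pd1 (pd1 f) p + pd2 (pd2 f) p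

/-- The `L^{2k}` norm over the period cell `Ω = [0,L₁] × [0,L₂]`. -/
noncomputable def lpNorm2k (L₁ L₂ : ℝ) (k : ℕ) (f : ℝ × ℝ → ℝ) : ℝ :=
  (∫ p in Set.Icc (0 : ℝ) L₁ ×ˢ Set.Icc (0 : ℝ) L₂, |f p| ^ (2 * k)) ^
    (1 / (2 * (k : ℝ)))

lemma hasDerivAt_pd1 {f : ℝ × ℝ → ℝ} (hf : ContDiff ℝ (⊤ : ℕ∞) f) (p : ℝ × ℝ) :
    HasDerivAt (fun s => f (s, p.2)) (pd1 f p) p.1 := by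
  have hf' : Differentiable ℝ f := hf.differentiable (by simp)
  have h : Differentiable ℝ fun s => f (s, p.2) := by fun_prop
  exact (h p.1).hasDerivAt

lemma hasDerivAt_pd2 {f : ℝ × ℝ → ℝ} (hf : ContDiff ℝ (⊤ : ℕ∞) f) (p : ℝ × ℝ) :
    HasDerivAt (fun s => f (p.1, s)) (pd2 f p) p.2 := by
  have hf' : Differentiable ℝ f := hf.differentiable (by simp)
  have h : Differentiable ℝ fun s => f (p.1, s) := by fun_prop
  exact (h p.2).hasDerivAt

lemma contDiff_pd1 {f : ℝ × ℝ → ℝ} (hf : ContDiff ℝ (⊤ : ℕ∞) f) :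
    ContDiff ℝ (⊤ : ℕ∞) (pd1 f) := by
  have h : pd1 f = fun p => fderiv ℝ f p (1, 0) := by
    funext p
    have h1 : HasDerivAt (fun s : ℝ => (s, p.2)) ((1 : ℝ), (0 : ℝ)) p.1 :=
      (hasDerivAt_id p.1).prodMk (hasDerivAt_const p.1 p.2)
    have h2 : HasFDerivAt f (fderiv ℝ f p) (p.1, p.2) :=
      ((hf.differentiable (by simp)) p).hasFDerivAt
    exact (h2.comp_hasDerivAt p.1 h1).deriv
  rw [h]
  exact (hf.fderiv_right (m := (⊤ : ℕ∞)) (by simp)).clm_apply contDiff_const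

lemma contDiff_pd2 {f : ℝ × ℝ → ℝ} (hf : ContDiff ℝ (⊤ : ℕ∞) f) :
    ContDiff ℝ (⊤ : ℕ∞) (pd2 f) := by
  have h : pd2 f = fun p => fderiv ℝ f p (0, 1) := by
    funext p
    have h1 : HasDerivAt (fun s : ℝ => (p.1, s)) ((0 : ℝ), (1 : ℝ)) p.2 :=
      (hasDerivAt_const p.2 p.1).prodMk (hasDerivAt_id p.2)
    have h2 : HasFDerivAt f (fderiv ℝ f p) (p.1, p.2) :=
      ((hf.differentiable (by simp)) p).hasFDerivAt
    exact (h2.comp_hasDerivAt p.2 h1).deriv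
  rw [h]
  exact (hf.fderiv_right (m := (⊤ : ℕ∞)) (by simp)).clm_apply contDiff_const

lemma pd1_add_period {f : ℝ × ℝ → ℝ} {a b : ℝ} (h : ∀ x : ℝ × ℝ, f (x.1 + a, x.2 + b) = f x)
    (x : ℝ × ℝ) : pd1 f (x.1 + a, x.2 + b) = pd1 f x := by
  simp only [pd1]
  rw [← deriv_comp_add_const]
  congr 1
  funext s
  exact h (s, x.2)

lemma pd2_add_period {f : ℝ × ℝ → ℝ} {a b : ℝ} (h : ∀ x : ℝ × ℝ, f (x.1 + a, x.2 + b) = f x)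
    (x : ℝ × ℝ) : pd2 f (x.1 + a, x.2 + b) = pd2 f x := by
  simp only [pd2]
  rw [← deriv_comp_add_const]
  congr 1
  funext s
  exact h (x.1, s)

lemma integrableOn_cell {f : ℝ × ℝ → ℝ} (hf : Continuous f) (L₁ L₂ : ℝ) :
    IntegrableOn f (Set.Icc (0 : ℝ) L₁ ×ˢ Set.Icc (0 : ℝ) L₂) :=
  hf.continuousOn.integrableOn_compact (isCompact_Icc.prod isCompact_Icc)

lemma integral_cell_pd2_eq_zero {f : ℝ × ℝ → ℝ} (hf : ContDiff ℝ (⊤ : ℕ∞) f) {L₁ L₂ : ℝ}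
    (hL₂ : 0 ≤ L₂) (hper : ∀ x : ℝ × ℝ, f (x.1, x.2 + L₂) = f x) :
    ∫ p in Set.Icc (0 : ℝ) L₁ ×ˢ Set.Icc (0 : ℝ) L₂, pd2 f p = 0 := by
  have hc := (contDiff_pd2 hf).continuous
  have hi := integrableOn_cell hc L₁ L₂
  rw [Measure.volume_eq_prod] at hi ⊢
  rw [setIntegral_prod _ hi]
  refine integral_eq_zero_of_ae (.of_forall fun x => ?_)
  simp only [Pi.zero_apply]
  rw [integral_Icc_eq_integral_Ioc, ← intervalIntegral.integral_of_le hL₂,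
    intervalIntegral.integral_eq_sub_of_hasDerivAt
      (f := fun s => f (x, s)) (fun y _ => hasDerivAt_pd2 hf (x, y))
      (Continuous.intervalIntegrable (by fun_prop) _ _)]
  have := hper (x, 0)
  simp only [zero_add] at this
  rw [this, sub_self]

lemma integral_cell_pd1_eq_zero {f : ℝ × ℝ → ℝ} (hf : ContDiff ℝ (⊤ : ℕ∞) f) {L₁ L₂ : ℝ}
    (hL₁ : 0 ≤ L₁) (hper : ∀ x : ℝ × ℝ, f (x.1 + L₁, x.2) = f x) :
    ∫ p in Set.Icc (0 : ℝ) L₁ ×ˢ Set.Icc (0 : ℝ) L₂, pd1 f p = 0 := by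
  have hs : ContDiff ℝ (⊤ : ℕ∞) fun p : ℝ × ℝ => f p.swap :=
    hf.comp (contDiff_snd.prodMk contDiff_fst)
  have h := integral_cell_pd2_eq_zero hs (L₁ := L₂) hL₁ fun x => hper x.swap
  rw [Measure.volume_eq_prod] at h ⊢
  rw [← setIntegral_prod_swap]
  exact h

lemma lpNorm2k_nonneg (L₁ L₂ : ℝ) (k : ℕ) (f : ℝ × ℝ → ℝ) : 0 ≤ lpNorm2k L₁ L₂ k f :=
  rpow_nonneg (integral_nonneg fun _ => by positivity) _

lemma lpNorm2k_pow (L₁ L₂ : ℝ) {k : ℕ} (hk : 1 ≤ k) (f : ℝ × ℝ → ℝ) :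
    lpNorm2k L₁ L₂ k f ^ (2 * k) =
      ∫ p in Set.Icc (0 : ℝ) L₁ ×ˢ Set.Icc (0 : ℝ) L₂, f p ^ (2 * k) := by
  have h0 : 0 ≤ ∫ p in Set.Icc (0 : ℝ) L₁ ×ˢ Set.Icc (0 : ℝ) L₂, |f p| ^ (2 * k) :=
    integral_nonneg fun _ => by positivity
  have h := rpow_inv_natCast_pow h0 (n := 2 * k) (by omega)
  simp only [lpNorm2k, one_div]
  push_cast at h
  rw [h]
  simp only [(even_two_mul k).pow_abs]

/-- Hölder's inequality for `f ^ (2k - 1) * h` on the period cell. -/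
lemma integral_cell_pow_mul_le (L₁ L₂ : ℝ) {k : ℕ} (hk : 1 ≤ k) {f h : ℝ × ℝ → ℝ}
    (hf : Continuous f) (hh : Continuous h) :
    ∫ p in Set.Icc (0 : ℝ) L₁ ×ˢ Set.Icc (0 : ℝ) L₂, f p ^ (2 * k - 1) * h p ≤
      lpNorm2k L₁ L₂ k f ^ (2 * k - 1) * lpNorm2k L₁ L₂ k h := by
  have hk' : (1 : ℝ) ≤ k := by exact_mod_cast hk
  have hn : ((2 * k - 1 : ℕ) : ℝ) = 2 * k - 1 := by
    rw [Nat.cast_sub (by omega)]; push_cast; ring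
  have hpq : (2 * (k : ℝ) / (2 * k - 1)).HolderConjugate (2 * k) := by
    rw [Real.holderConjugate_iff]
    refine ⟨(one_lt_div (by linarith)).2 (by linarith), ?_⟩
    rw [inv_div]
    field_simp
    ring
  have hmem : ∀ {u : ℝ × ℝ → ℝ} (p : ENNReal), Continuous u → MemLp u p
      (volume.restrict (Set.Icc (0 : ℝ) L₁ ×ˢ Set.Icc (0 : ℝ) L₂)) := fun p hu => by
    have hK : IsCompact (Set.Icc (0 : ℝ) L₁ ×ˢ Set.Icc (0 : ℝ) L₂) :=
      isCompact_Icc.prod isCompact_Icc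
    have : IsFiniteMeasure (volume.restrict (Set.Icc (0 : ℝ) L₁ ×ˢ Set.Icc (0 : ℝ) L₂)) :=
      isFiniteMeasure_restrict.2 hK.measure_ne_top
    obtain ⟨C, hC⟩ := hK.exists_bound_of_continuousOn hu.continuousOn
    exact MemLp.of_bound hu.aestronglyMeasurable C
      (ae_restrict_of_forall_mem hK.measurableSet hC)
  have key := integral_mul_le_Lp_mul_Lq_of_nonneg
    (μ := volume.restrict (Set.Icc (0 : ℝ) L₁ ×ˢ Set.Icc (0 : ℝ) L₂)) hpq
    (f := fun p => |f p| ^ (2 * k - 1)) (g := fun p => |h p|)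
    (.of_forall fun _ => by positivity) (.of_forall fun _ => by positivity)
    (hmem _ (by fun_prop)) (hmem _ (by fun_prop))
  have hle : ∫ p in Set.Icc (0 : ℝ) L₁ ×ˢ Set.Icc (0 : ℝ) L₂, f p ^ (2 * k - 1) * h p ≤
      ∫ p in Set.Icc (0 : ℝ) L₁ ×ˢ Set.Icc (0 : ℝ) L₂, |f p| ^ (2 * k - 1) * |h p| := by
    refine integral_mono (integrableOn_cell (by fun_prop) _ _)
      (integrableOn_cell (by fun_prop) _ _) fun p => ?_
    simp only [← abs_pow, ← abs_mul]
    exact le_abs_self _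
  refine (hle.trans key).trans_eq ?_
  simp only [lpNorm2k]
  have h1 : ∀ p, (|f p| ^ (2 * k - 1)) ^ (2 * (k : ℝ) / (2 * k - 1)) = |f p| ^ (2 * k) := by
    intro p
    rw [← rpow_natCast, ← rpow_mul (abs_nonneg _), hn, ← rpow_natCast]
    congr 1
    have : (2 * (k : ℝ) - 1) ≠ 0 := by linarith
    push_cast
    field_simp
  have h2 : ∀ p, |h p| ^ (2 * (k : ℝ)) = |h p| ^ (2 * k) := by
    intro p
    rw [← rpow_natCast]
    push_cast
    rfl
  simp only [h1, h2]
  congr 1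
  rw [← rpow_mul_natCast (integral_nonneg fun _ => by positivity), hn]
  congr 1
  field_simp

lemma hasDerivAt_integral_cell {F : ℝ → ℝ × ℝ → ℝ}
    (hF : ContDiff ℝ (⊤ : ℕ∞) (fun q : ℝ × ℝ × ℝ => F q.1 q.2)) (L₁ L₂ t : ℝ) :
    HasDerivAt (fun s => ∫ p in Set.Icc (0 : ℝ) L₁ ×ˢ Set.Icc (0 : ℝ) L₂, F s p)
      (∫ p in Set.Icc (0 : ℝ) L₁ ×ˢ Set.Icc (0 : ℝ) L₂, deriv (fun s => F s p) t) t := by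
  have hd : Differentiable ℝ (fun q : ℝ × ℝ × ℝ => F q.1 q.2) := hF.differentiable (by simp)
  have hderiv : ∀ s p, HasDerivAt (fun s => F s p) (deriv (fun s => F s p) s) s := by
    intro s p
    have h : Differentiable ℝ fun s => F s p :=
      hd.comp (differentiable_id.prodMk (differentiable_const p))
    exact (h s).hasDerivAt
  have hcont : Continuous fun q : ℝ × ℝ × ℝ => deriv (fun s => F s q.2) q.1 := by
    have h : (fun q : ℝ × ℝ × ℝ => deriv (fun s => F s q.2) q.1) =
        fun q => fderiv ℝ (fun q : ℝ × ℝ × ℝ => F q.1 q.2) q (1, 0) := by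
      funext q
      have h1 : HasDerivAt (fun s : ℝ => (s, q.2)) ((1 : ℝ), (0 : ℝ × ℝ)) q.1 :=
        (hasDerivAt_id q.1).prodMk (hasDerivAt_const q.1 q.2)
      have h2 : HasFDerivAt (fun q : ℝ × ℝ × ℝ => F q.1 q.2) (fderiv ℝ _ q) (q.1, q.2) :=
        (hd q).hasFDerivAt
      exact (h2.comp_hasDerivAt q.1 h1).deriv
    rw [h]
    exact (hF.continuous_fderiv (by simp)).clm_apply continuous_const
  have hFc : ∀ s, Continuous (F s) := fun s => hF.continuous.comp (by fun_prop :
    Continuous fun p : ℝ × ℝ => (s, p))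
  obtain ⟨C, hC⟩ := ((isCompact_closedBall t 1).prod
    ((isCompact_Icc (a := (0 : ℝ)) (b := L₁)).prod
      (isCompact_Icc (a := (0 : ℝ)) (b := L₂)))).exists_bound_of_continuousOn hcont.continuousOn
  refine (hasDerivAt_integral_of_dominated_loc_of_deriv_le (bound := fun _ => C)
    (F' := fun s p => deriv (fun s => F s p) s)
    (Metric.closedBall_mem_nhds t one_pos)
    (.of_forall fun s => (hFc s).aestronglyMeasurable)
    (integrableOn_cell (hFc t) _ _)
    (hcont.comp (by fun_prop : Continuous fun p : ℝ × ℝ => (t, p))).aestronglyMeasurable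
    ?_ (integrableOn_cell continuous_const _ _)
    (.of_forall fun p s _ => hderiv s p)).2
  filter_upwards [ae_restrict_mem (measurableSet_Icc.prod measurableSet_Icc)] with p hp s hs
  exact hC (s, p) ⟨hs, hp⟩

lemma pow_mul_drift_diffusion_le_div {f u₁ u₂ : ℝ × ℝ → ℝ} {ν : ℝ} (hν : 0 ≤ ν) {k : ℕ}
    (hk : 1 ≤ k) (hf : ContDiff ℝ (⊤ : ℕ∞) f) (hu₁ : ContDiff ℝ (⊤ : ℕ∞) u₁)
    (hu₂ : ContDiff ℝ (⊤ : ℕ∞) u₂) (hdiv : ∀ x, pd1 u₁ x + pd2 u₂ x = 0) (x : ℝ × ℝ) :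
    2 * k * f x ^ (2 * k - 1) * (ν * lap f x - (u₁ x * pd1 f x + u₂ x * pd2 f x)) ≤
      pd1 (fun p => ν * (2 * k * f p ^ (2 * k - 1) * pd1 f p) - u₁ p * f p ^ (2 * k)) x +
      pd2 (fun p => ν * (2 * k * f p ^ (2 * k - 1) * pd2 f p) - u₂ p * f p ^ (2 * k)) x := by
  obtain ⟨m, rfl⟩ : ∃ m, k = m + 1 := ⟨k - 1, by omega⟩
  have e1 : 2 * (m + 1) - 1 = 2 * m + 1 := by omega
  have h1 := ((((((hasDerivAt_pd1 hf x).fun_pow (2 * (m + 1) - 1)).const_mul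
    (2 * ((m + 1 : ℕ) : ℝ))).mul (hasDerivAt_pd1 (contDiff_pd1 hf) x)).const_mul ν).sub
    ((hasDerivAt_pd1 hu₁ x).mul ((hasDerivAt_pd1 hf x).fun_pow (2 * (m + 1))))).deriv
  have h2 := ((((((hasDerivAt_pd2 hf x).fun_pow (2 * (m + 1) - 1)).const_mul
    (2 * ((m + 1 : ℕ) : ℝ))).mul (hasDerivAt_pd2 (contDiff_pd2 hf) x)).const_mul ν).sub
    ((hasDerivAt_pd2 hu₂ x).mul ((hasDerivAt_pd2 hf x).fun_pow (2 * (m + 1))))).deriv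
  have h1' : pd1 (fun p => ν * (2 * ((m + 1 : ℕ) : ℝ) * f p ^ (2 * (m + 1) - 1) * pd1 f p) -
    u₁ p * f p ^ (2 * (m + 1))) x = _ := h1
  have h2' : pd2 (fun p => ν * (2 * ((m + 1 : ℕ) : ℝ) * f p ^ (2 * (m + 1) - 1) * pd2 f p) -
    u₂ p * f p ^ (2 * (m + 1))) x = _ := h2
  rw [h1', h2']
  simp only [e1, lap, Nat.add_sub_cancel]
  have hd : pd2 u₂ x = - pd1 u₁ x := by linarith [hdiv x]
  rw [hd]
  have hnn : 0 ≤ ν * (2 * (m + 1) * (2 * m + 1)) *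
      ((f x ^ m) ^ 2 * (pd1 f x ^ 2 + pd2 f x ^ 2)) := by
    positivity
  rw [← sub_nonneg]
  refine hnn.trans_eq ?_
  push_cast
  ring

lemma integral_pow_mul_drift_diffusion_nonpos {f u₁ u₂ : ℝ × ℝ → ℝ} {ν : ℝ} (hν : 0 ≤ ν) {k : ℕ}
    (hk : 1 ≤ k) (hf : ContDiff ℝ (⊤ : ℕ∞) f) (hu₁ : ContDiff ℝ (⊤ : ℕ∞) u₁)
    (hu₂ : ContDiff ℝ (⊤ : ℕ∞) u₂) (hdiv : ∀ x, pd1 u₁ x + pd2 u₂ x = 0)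
    {L₁ L₂ : ℝ} (hL₁ : 0 ≤ L₁) (hL₂ : 0 ≤ L₂)
    (hf1 : ∀ x : ℝ × ℝ, f (x.1 + L₁, x.2) = f x) (hf2 : ∀ x : ℝ × ℝ, f (x.1, x.2 + L₂) = f x)
    (hu1 : ∀ x : ℝ × ℝ, u₁ (x.1 + L₁, x.2) = u₁ x)
    (hu2 : ∀ x : ℝ × ℝ, u₂ (x.1, x.2 + L₂) = u₂ x) :
    ∫ x in Set.Icc (0 : ℝ) L₁ ×ˢ Set.Icc (0 : ℝ) L₂,
      2 * k * f x ^ (2 * k - 1) * (ν * lap f x - (u₁ x * pd1 f x + u₂ x * pd2 f x)) ≤ 0 := by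
  have c1 := contDiff_pd1 hf
  have c2 := contDiff_pd2 hf
  have c11 := (contDiff_pd1 c1).continuous
  have c22 := (contDiff_pd2 c2).continuous
  have hA : ContDiff ℝ (⊤ : ℕ∞)
      fun p => ν * (2 * k * f p ^ (2 * k - 1) * pd1 f p) - u₁ p * f p ^ (2 * k) := by fun_prop
  have hB : ContDiff ℝ (⊤ : ℕ∞)
      fun p => ν * (2 * k * f p ^ (2 * k - 1) * pd2 f p) - u₂ p * f p ^ (2 * k) := by fun_prop
  have p1 : ∀ x : ℝ × ℝ, pd1 f (x.1 + L₁, x.2) = pd1 f x := fun x => by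
    simpa using pd1_add_period (a := L₁) (b := 0) (by simpa using hf1) x
  have p2 : ∀ x : ℝ × ℝ, pd2 f (x.1, x.2 + L₂) = pd2 f x := fun x => by
    simpa using pd2_add_period (a := 0) (b := L₂) (by simpa using hf2) x
  have iA := integral_cell_pd1_eq_zero hA (L₂ := L₂) hL₁ fun x => by simp only [hf1, p1, hu1]
  have iB := integral_cell_pd2_eq_zero hB (L₁ := L₁) hL₂ fun x => by simp only [hf2, p2, hu2]
  have cf := hf.continuous
  have cu1 := hu₁.continuous
  have cu2 := hu₂.continuous
  have cc1 := c1.continuous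
  have cc2 := c2.continuous
  have hl : Continuous (lap f) := c11.add c22
  have hle := integral_mono (integrableOn_cell (f := fun x =>
      2 * k * f x ^ (2 * k - 1) * (ν * lap f x - (u₁ x * pd1 f x + u₂ x * pd2 f x)))
      (by fun_prop) L₁ L₂)
    ((integrableOn_cell (contDiff_pd1 hA).continuous L₁ L₂).add
      (integrableOn_cell (contDiff_pd2 hB).continuous L₁ L₂))
    (pow_mul_drift_diffusion_le_div hν hk hf hu₁ hu₂ hdiv)
  refine hle.trans_eq ?_
  rw [integral_add' (integrableOn_cell (contDiff_pd1 hA).continuous L₁ L₂)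
      (integrableOn_cell (contDiff_pd2 hB).continuous L₁ L₂), iA, iB, add_zero]

/-- Comparison principle for `E' ≤ n (-μ E + M E^(1 - 1/n))`, with the right-hand side evaluated
only at the points where `E = z ^ n` for some `z > 0`. -/
lemma le_pow_of_deriv_le {E E' : ℝ → ℝ} {n : ℕ} (hn : 1 ≤ n) {μ M y τ t : ℝ} (hμ : 0 < μ)
    (hM : 0 ≤ M) (hy : 0 ≤ y) (ht : 0 ≤ t) (hE : ∀ s, HasDerivAt E (E' s) s)
    (h0 : E τ ≤ y ^ n)
    (hE' : ∀ s, τ ≤ s → ∀ z, 0 < z → E s = z ^ n →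
      E' s ≤ n * z ^ (n - 1) * (-μ * z + M)) :
    E (t + τ) ≤ (y * exp (-μ * t) + μ⁻¹ * M * (1 - exp (-μ * t))) ^ n := by
  have hlim : Filter.Tendsto
      (fun ε => (y * exp (-μ * t) + μ⁻¹ * M * (1 - exp (-μ * t)) + ε) ^ n)
      (nhdsWithin 0 (Set.Ioi 0))
      (nhds ((y * exp (-μ * t) + μ⁻¹ * M * (1 - exp (-μ * t)) + 0) ^ n)) :=
    (Continuous.tendsto (by fun_prop) 0).mono_left nhdsWithin_le_nhds
  rw [add_zero] at hlim
  refine ge_of_tendsto hlim (eventually_nhdsWithin_of_forall fun ε (hε : 0 < ε) => ?_)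
  set z : ℝ → ℝ := fun s =>
    y * exp (-μ * (s - τ)) + μ⁻¹ * M * (1 - exp (-μ * (s - τ))) + ε with hz
  have hzd : ∀ s, HasDerivAt z (-μ * (z s - ε) + M) s := by
    intro s
    have he : HasDerivAt (fun s => exp (-μ * (s - τ))) (exp (-μ * (s - τ)) * (-μ * 1)) s :=
      (((hasDerivAt_id s).sub_const τ).const_mul (-μ)).exp
    refine (((he.const_mul y).add ((he.const_sub 1).const_mul (μ⁻¹ * M))).add_const ε).congr_deriv ?_
    simp only [hz]
    field_simp
    ring
  have hzpos : ∀ s, τ ≤ s → 0 < z s := by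
    intro s hs
    have h1 : exp (-μ * (s - τ)) ≤ 1 := exp_le_one_iff.2 (by nlinarith)
    have h2 : 0 ≤ μ⁻¹ * M * (1 - exp (-μ * (s - τ))) :=
      mul_nonneg (by positivity) (by linarith)
    have h3 : 0 ≤ y * exp (-μ * (s - τ)) := by positivity
    simp only [hz]
    linarith
  have key := image_le_of_deriv_right_lt_deriv_boundary (f := E) (f' := E') (a := τ) (b := t + τ)
    (B := fun s => z s ^ n) (fun s _ => (hE s).continuousAt.continuousWithinAt)
    (fun s _ => (hE s).hasDerivWithinAt)
    (h0.trans (by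
      have : z τ = y + ε := by simp [hz]
      simp only [this]
      gcongr
      linarith))
    (fun s => (hzd s).fun_pow n)
    (fun s hs hEs => (hE' s hs.1 (z s) (hzpos s hs.1) hEs).trans_lt (by
      have := hzpos s hs.1
      have hn' : (0 : ℝ) < n := by exact_mod_cast hn
      have : 0 < μ * ε := by positivity
      exact mul_lt_mul_of_pos_left (by linarith) (by positivity)))
    (Set.right_mem_Icc.2 (by linarith))
  simpa [hz] using key

/-- `L^{2k}` decay estimate for the damped transport–diffusion equation
`∂ₜφ + v·∇φ = νΔφ − μφ + g` with divergence-free `v`: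
`‖φ(t+τ)‖_{2k} ≤ ‖φ(τ)‖_{2k} e^{−μt} + μ⁻¹ sup_{s ≥ τ} ‖g(s)‖_{2k} (1 − e^{−μt})`. -/
theorem L2k_decay_damped_transport
    (L₁ L₂ : ℝ) (hL₁ : 0 < L₁) (hL₂ : 0 < L₂)
    (ν μ : ℝ) (hν : 0 < ν) (hμ : 0 < μ)
    (k : ℕ) (hk : 1 ≤ k)
    (φ g : ℝ → ℝ × ℝ → ℝ) (v : ℝ → ℝ × ℝ → ℝ × ℝ)
    (hφ : ContDiff ℝ (⊤ : ℕ∞) (fun q : ℝ × ℝ × ℝ => φ q.1 q.2))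
    (hv : ContDiff ℝ (⊤ : ℕ∞) (fun q : ℝ × ℝ × ℝ => v q.1 q.2))
    (hg : ContDiff ℝ (⊤ : ℕ∞) (fun q : ℝ × ℝ × ℝ => g q.1 q.2))
    (hφper1 : ∀ t : ℝ, ∀ x : ℝ × ℝ, φ t (x.1 + L₁, x.2) = φ t x)
    (hφper2 : ∀ t : ℝ, ∀ x : ℝ × ℝ, φ t (x.1, x.2 + L₂) = φ t x)
    (hvper1 : ∀ t : ℝ, ∀ x : ℝ × ℝ, v t (x.1 + L₁, x.2) = v t x)
    (hvper2 : ∀ t : ℝ, ∀ x : ℝ × ℝ, v t (x.1, x.2 + L₂) = v t x)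
    (hgper1 : ∀ t : ℝ, ∀ x : ℝ × ℝ, g t (x.1 + L₁, x.2) = g t x)
    (hgper2 : ∀ t : ℝ, ∀ x : ℝ × ℝ, g t (x.1, x.2 + L₂) = g t x)
    (hdiv : ∀ t : ℝ, ∀ x : ℝ × ℝ,
      pd1 (fun y => (v t y).1) x + pd2 (fun y => (v t y).2) x = 0)
    (hpde : ∀ t : ℝ, 0 ≤ t → ∀ x : ℝ × ℝ,
      deriv (fun s => φ s x) t +
        ((v t x).1 * pd1 (φ t) x + (v t x).2 * pd2 (φ t) x) =
      ν * lap (φ t) x - μ * φ t x + g t x)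
    (τ t : ℝ) (hτ : 0 ≤ τ) (ht : 0 ≤ t)
    (hbdd : BddAbove (Set.range fun s : {s : ℝ // τ ≤ s} => lpNorm2k L₁ L₂ k (g s.1))) :
    lpNorm2k L₁ L₂ k (φ (t + τ)) ≤
      lpNorm2k L₁ L₂ k (φ τ) * Real.exp (-μ * t) +
      μ⁻¹ * (⨆ s : {s : ℝ // τ ≤ s}, lpNorm2k L₁ L₂ k (g s.1)) *
        (1 - Real.exp (-μ * t)) := by
  have slice : ∀ s : ℝ, ContDiff ℝ (⊤ : ℕ∞) fun p : ℝ × ℝ => (s, p) := fun s =>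
    contDiff_const.prodMk contDiff_id
  have hφs : ∀ s, ContDiff ℝ (⊤ : ℕ∞) (φ s) := fun s => hφ.comp (slice s)
  have hgs : ∀ s, ContDiff ℝ (⊤ : ℕ∞) (g s) := fun s => hg.comp (slice s)
  have hvs : ∀ s, ContDiff ℝ (⊤ : ℕ∞) (v s) := fun s => hv.comp (slice s)
  set M := ⨆ s : {s : ℝ // τ ≤ s}, lpNorm2k L₁ L₂ k (g s.1) with hMdef
  have hgM : ∀ s, τ ≤ s → lpNorm2k L₁ L₂ k (g s) ≤ M := fun s hs => le_ciSup hbdd ⟨s, hs⟩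
  have hM : 0 ≤ M := (lpNorm2k_nonneg _ _ _ _).trans (hgM τ le_rfl)
  have hy := lpNorm2k_nonneg L₁ L₂ k (φ τ)
  have hpow : ContDiff ℝ (⊤ : ℕ∞) fun q : ℝ × ℝ × ℝ => φ q.1 q.2 ^ (2 * k) := hφ.pow _
  have hexp : exp (-μ * t) ≤ 1 := exp_le_one_iff.2 (by nlinarith)
  have hrhs : 0 ≤ lpNorm2k L₁ L₂ k (φ τ) * exp (-μ * t) + μ⁻¹ * M * (1 - exp (-μ * t)) :=
    add_nonneg (by positivity) (mul_nonneg (by positivity) (by linarith))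
  refine le_of_pow_le_pow_left₀ (n := 2 * k) (by omega) hrhs ?_
  rw [lpNorm2k_pow L₁ L₂ hk]
  refine le_pow_of_deriv_le (by omega) hμ hM hy ht
    (fun s => hasDerivAt_integral_cell (F := fun s p => φ s p ^ (2 * k)) hpow L₁ L₂ s)
    (lpNorm2k_pow L₁ L₂ hk _).ge fun s hs z hz hEz => ?_
  have hnorm : lpNorm2k L₁ L₂ k (φ s) = z := by
    rw [← lpNorm2k_pow L₁ L₂ hk] at hEz
    exact (pow_left_inj₀ (lpNorm2k_nonneg _ _ _ _) hz.le (by omega)).1 hEz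
  have hder : ∀ p, deriv (fun s => φ s p ^ (2 * k)) s =
      2 * k * φ s p ^ (2 * k - 1) * (ν * lap (φ s) p -
        ((v s p).1 * pd1 (φ s) p + (v s p).2 * pd2 (φ s) p)) +
      (-(2 * k * μ) * φ s p ^ (2 * k) + 2 * k * (φ s p ^ (2 * k - 1) * g s p)) := by
    intro p
    have hd : Differentiable ℝ fun s => φ s p :=
      (hφ.differentiable (by simp)).comp (differentiable_id.prodMk (differentiable_const p))
    rw [((hd s).hasDerivAt.fun_pow (2 * k)).deriv, eq_sub_of_add_eq (hpde s (hτ.trans hs) p)]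
    have hp : φ s p ^ (2 * k) = φ s p ^ (2 * k - 1) * φ s p := by
      rw [← pow_succ]; congr 1; omega
    rw [hp]
    push_cast
    ring
  have cφ := (hφs s).continuous
  have cg := (hgs s).continuous
  have cv := (hvs s).continuous
  have c1 := (contDiff_pd1 (hφs s)).continuous
  have c2 := (contDiff_pd2 (hφs s)).continuous
  have cl : Continuous (lap (φ s)) :=
    (contDiff_pd1 (contDiff_pd1 (hφs s))).continuous.add
      (contDiff_pd2 (contDiff_pd2 (hφs s))).continuous
  have hdrift := integral_pow_mul_drift_diffusion_nonpos hν.le hk (hφs s)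
    (contDiff_fst.comp (hvs s)) (contDiff_snd.comp (hvs s)) (hdiv s) hL₁.le hL₂.le
    (hφper1 s) (hφper2 s) (fun x => by simp [hvper1]) (fun x => by simp [hvper2])
  simp only [Function.comp_apply] at hdrift
  have hholder := integral_cell_pow_mul_le L₁ L₂ hk cφ cg
  simp only [hder]
  rw [integral_add (integrableOn_cell (by fun_prop) _ _) (integrableOn_cell (by fun_prop) _ _),
    integral_add (integrableOn_cell (by fun_prop) _ _) (integrableOn_cell (by fun_prop) _ _),
    integral_const_mul, integral_const_mul, hEz]
  rw [hnorm] at hholder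
  have hsource := hholder.trans
    (mul_le_mul_of_nonneg_left (hgM s hs) (pow_nonneg hz.le (2 * k - 1)))
  have hsource' := mul_le_mul_of_nonneg_left hsource (by positivity : (0 : ℝ) ≤ 2 * k)
  have hp : z ^ (2 * k) = z ^ (2 * k - 1) * z := by
    rw [← pow_succ]; congr 1; omega
  rw [hp]
  push_cast
  linarith
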